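/- Define B(n,j) as in the Fuss-Catalan block triangle: B(0,0)=1, B(n,0)=0 for n>0, B(n,j) = \sum_{k=j-1}^{n-1} B(n-1,k)\binom{k-j+3}{2} for n \ge 1, 1 \le j \le n. Then for every n \ge 1, \sum_{j=1}^{n} B(n,j) \binom{j+3}{3} = \sum_{j'=1}^{n+1} B(n+1,j'), i.e., the weighted row sum of row n equals the row sum of row n+1. -/

import Mathlib

/-- The Fuss-Catalan triangle `F(n,k)`. -/
def F : ℕ → ℕ → ℕ
  | 0, k => if k = 0 then 1 else 0
  | n + 1, k =>
    if k = n + 1 then 0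
    else ∑ j ∈ Finset.range (k + 1), (k - j + 2).choose 2 * F n j

/-- `B(n,j)`: the block triangle, with `B(0,0)=1`, `B(n,0)=0` for `n>0`, and
`B(n,j) = ∑_{k=j-1}^{n-1} B(n-1,k) * C(k-j+3,2)` for `n ≥ 1`, `j ≥ 1`. -/
def B : ℕ → ℕ → ℕ
  | 0, j => if j = 0 then 1 else 0
  | n + 1, j =>
    if j = 0 then 0
    else ∑ k ∈ Finset.Icc (j - 1) n, B n k * (k + 3 - j).choose 2

theorem sum_Icc_one_choose_two (k : ℕ) :
    ∑ j ∈ Finset.Icc 1 (k + 1), (k + 3 - j).choose 2 = (k + 3).choose 3 := by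
  rw [← Nat.sum_Icc_choose (k + 2) 2]
  refine Finset.sum_nbij' (fun j => k + 3 - j) (fun j => k + 3 - j) ?_ ?_ ?_ ?_ ?_ <;>
    intro j hj <;> simp only [Finset.mem_Icc] at * <;> omega

theorem block_triangle_weighted_row_sum (n : ℕ) (hn : 1 ≤ n) :
    ∑ j ∈ Finset.Icc 1 n, B n j * (j + 3).choose 3 =
      ∑ j ∈ Finset.Icc 1 (n + 1), B (n + 1) j := by
  obtain ⟨m, rfl⟩ : ∃ m, n = m + 1 := ⟨n - 1, by omega⟩
  have h : ∀ j ∈ Finset.Icc 1 (m + 1 + 1), B (m + 1 + 1) j =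
      ∑ k ∈ Finset.Icc (j - 1) (m + 1), B (m + 1) k * (k + 3 - j).choose 2 := by
    intro j hj
    rw [B, if_neg (by have := (Finset.mem_Icc.mp hj).1; omega)]
  rw [Finset.sum_congr rfl h, Finset.sum_comm' (t' := Finset.Icc 0 (m + 1))
    (s' := fun k => Finset.Icc 1 (k + 1)) (by simp only [Finset.mem_Icc]; omega)]
  simp_rw [← Finset.mul_sum, sum_Icc_one_choose_two]
  refine Finset.sum_subset (Finset.Icc_subset_Icc_left (Nat.zero_le 1)) fun k hk hk' => ?_
  obtain rfl : k = 0 := by simp only [Finset.mem_Icc] at hk hk'; omega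
  simp [B]
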